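/- For every integer k ≥ 5, the union over s ≥ 1 of the translated Minkowski sums k + (C̃_k(β^s) + C_k(γ^s)) and k + (C_k(β^s) + C_k(β^s)) covers the half-open interval [1 + √(k²+2k−3), √(k²+4k)): that is, ⋃_{s≥1} [ (k + C̃_k(β^s) + C_k(γ^s)) ∪ (k + C_k(β^s) + C_k(β^s)) ] ⊇ [1 + √(k²+2k−3), √(k²+4k)). -/

import Mathlib

open Filter Set
open scoped Pointwise

noncomputable section

/-- The `n`-th convergent of the continued fraction `[0; a 0, a 1, a 2, …]`. -/
def cfConv : ℕ → (ℕ → ℕ) → ℝ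
  | 0, _ => 0
  | n + 1, a => 1 / (a 0 + cfConv n fun i => a (i + 1))

/-- The value `[0; a 0, a 1, a 2, …]` of the infinite continued fraction with
partial quotients `a 0, a 1, …` (the limit of its convergents). -/
def cfVal (a : ℕ → ℕ) : ℝ := limUnder atTop fun n => cfConv n a

/-- The sequence of partial quotients obtained by concatenating the finite word `b`
with the sequence `θ`. -/
def app (b : List ℕ) (θ : ℕ → ℕ) : ℕ → ℕ := fun n =>
  if h : n < b.length then b.get ⟨n, h⟩ else θ (n - b.length)

/-- `C_k(w) = {[0; w, θ] : θ_n ∈ {1,…,k-1} for all n}`. -/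
def Ck (k : ℕ) (w : List ℕ) : Set ℝ :=
  {x | ∃ θ : ℕ → ℕ, (∀ n, 1 ≤ θ n ∧ θ n ≤ k - 1) ∧ x = cfVal (app w θ)}

/-- `C̃_k(w)`: those `[0; w, θ]` with `θ_n ∈ {1,…,k-1}` and `(θ_1, θ_2) ≠ (1, k-1)`. -/
def Ctilk (k : ℕ) (w : List ℕ) : Set ℝ :=
  {x | ∃ θ : ℕ → ℕ, (∀ n, 1 ≤ θ n ∧ θ n ≤ k - 1) ∧ (θ 0, θ 1) ≠ (1, k - 1) ∧
    x = cfVal (app w θ)}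

/-- The word `β^s = (1,k)_s` (the empty word when `s = 0`). -/
def betaW (k s : ℕ) : List ℕ := (List.replicate s [1, k]).flatten

/-- The word `γ^s = (1,k)_{s-1}, 1, k-1`. -/
def gammaW (k s : ℕ) : List ℕ := betaW k (s - 1) ++ [1, k - 1]


open Topology

/-! ### Convergence of continued fractions -/

lemma cfConv_mem_Icc (n : ℕ) (a : ℕ → ℕ) (ha : ∀ i, 1 ≤ a i) : cfConv n a ∈ Icc (0 : ℝ) 1 := by
  induction n generalizing a with
  | zero => simp [cfConv]
  | succ n ih =>
    have h := (ih (fun i => a (i + 1)) fun i => ha _).1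
    have h1 : (1 : ℝ) ≤ a 0 := by exact_mod_cast ha 0
    rw [cfConv]
    exact ⟨by positivity, by rw [div_le_one (by linarith)]; linarith⟩

lemma abs_two_step_sub_le {a b x y : ℝ} (ha : 1 ≤ a) (hb : 1 ≤ b) (hx : 0 ≤ x) (hy : 0 ≤ y) :
    |1 / (a + 1 / (b + x)) - 1 / (a + 1 / (b + y))| ≤ |x - y| / 4 := by
  have h : 1 / (a + 1 / (b + x)) - 1 / (a + 1 / (b + y))
      = (x - y) / ((a * (b + x) + 1) * (a * (b + y) + 1)) := by
    have : a + 1 / (b + x) ≠ 0 := by positivity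
    have : a + 1 / (b + y) ≠ 0 := by positivity
    have : b + x ≠ 0 := by positivity
    have : b + y ≠ 0 := by positivity
    have : a * (b + x) + 1 ≠ 0 := by positivity
    have : a * (b + y) + 1 ≠ 0 := by positivity
    field_simp
    ring
  have hX : 2 ≤ a * (b + x) + 1 := by nlinarith
  have hY : 2 ≤ a * (b + y) + 1 := by nlinarith
  rw [h, abs_div, abs_of_pos (show 0 < (a * (b + x) + 1) * (a * (b + y) + 1) by positivity)]
  exact div_le_div_of_nonneg_left (abs_nonneg _) (by norm_num) (by nlinarith)

lemma abs_cfConv_sub_le (p q : ℕ) : ∀ (n : ℕ) (a : ℕ → ℕ), (∀ i, 1 ≤ a i) →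
    |cfConv (n + p) a - cfConv (n + q) a| ≤ 2 * (1 / 2) ^ n
  | 0, a, ha => by
    have h1 := cfConv_mem_Icc (0 + p) a ha
    have h2 := cfConv_mem_Icc (0 + q) a ha
    rw [abs_le]
    constructor <;> linarith [h1.1, h1.2, h2.1, h2.2]
  | 1, a, ha => by
    have h1 := cfConv_mem_Icc (1 + p) a ha
    have h2 := cfConv_mem_Icc (1 + q) a ha
    rw [abs_le]
    constructor <;> linarith [h1.1, h1.2, h2.1, h2.2]
  | n + 2, a, ha => by
    have ih := abs_cfConv_sub_le p q n (fun i => a (i + 1 + 1)) fun i => ha _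
    have hp := (cfConv_mem_Icc (n + p) (fun i => a (i + 1 + 1)) fun i => ha _).1
    have hq := (cfConv_mem_Icc (n + q) (fun i => a (i + 1 + 1)) fun i => ha _).1
    rw [show n + 2 + p = (n + p) + 1 + 1 by ring, show n + 2 + q = (n + q) + 1 + 1 by ring]
    simp only [cfConv]
    refine (abs_two_step_sub_le (by exact_mod_cast ha 0) (by exact_mod_cast ha (0 + 1)) hp hq).trans ?_
    rw [pow_add]
    linarith

lemma tendsto_cfConv (a : ℕ → ℕ) (ha : ∀ i, 1 ≤ a i) :
    Tendsto (fun n => cfConv n a) atTop (𝓝 (cfVal a)) := by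
  refine CauchySeq.tendsto_limUnder (cauchySeq_of_le_tendsto_0 (fun n => 2 * (1 / 2 : ℝ) ^ n) ?_ ?_)
  · intro n m l hn hm
    obtain ⟨p, rfl⟩ := Nat.exists_eq_add_of_le hn
    obtain ⟨q, rfl⟩ := Nat.exists_eq_add_of_le hm
    exact abs_cfConv_sub_le p q l a ha
  · simpa using (tendsto_pow_atTop_nhds_zero_of_lt_one (r := (1 / 2 : ℝ)) (by norm_num)
      (by norm_num)).const_mul 2

lemma cfVal_mem_Icc (a : ℕ → ℕ) (ha : ∀ i, 1 ≤ a i) : cfVal a ∈ Icc (0 : ℝ) 1 :=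
  isClosed_Icc.mem_of_tendsto (tendsto_cfConv a ha)
    (Eventually.of_forall fun n => cfConv_mem_Icc n a ha)

lemma cfVal_eq (a : ℕ → ℕ) (ha : ∀ i, 1 ≤ a i) :
    cfVal a = 1 / (a 0 + cfVal fun i => a (i + 1)) := by
  have h1 := (tendsto_cfConv a ha).comp (tendsto_add_atTop_nat 1)
  have h2 := tendsto_cfConv (fun i => a (i + 1)) fun i => ha _
  have h0 := (cfVal_mem_Icc (fun i => a (i + 1)) fun i => ha _).1
  have h3 : (1 : ℝ) ≤ a 0 := by exact_mod_cast ha 0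
  refine tendsto_nhds_unique h1 ?_
  exact tendsto_const_nhds.div (h2.const_add (a 0 : ℝ)) (by positivity)

lemma abs_cfConv_sub_cfVal_le (n : ℕ) (a : ℕ → ℕ) (ha : ∀ i, 1 ≤ a i) :
    |cfConv n a - cfVal a| ≤ 2 * (1 / 2) ^ n := by
  have h := ((tendsto_cfConv a ha).comp (tendsto_add_atTop_nat n)).const_sub (cfConv n a)
  refine le_of_tendsto h.abs (Eventually.of_forall fun p => ?_)
  simpa [add_comm] using abs_cfConv_sub_le 0 p n a ha

lemma continuousOn_cfConv (n : ℕ) : ContinuousOn (cfConv n) {a | ∀ i, 1 ≤ a i} := by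
  induction n with
  | zero => exact continuousOn_const
  | succ n ih =>
    have hs : ContinuousOn (fun a : ℕ → ℕ => cfConv n fun i => a (i + 1)) {a | ∀ i, 1 ≤ a i} :=
      ih.comp (Continuous.continuousOn (by fun_prop)) fun a ha i => ha _
    have h0 : ContinuousOn (fun a : ℕ → ℕ => (a 0 : ℝ)) {a | ∀ i, 1 ≤ a i} :=
      ((continuous_of_discreteTopology (f := fun m : ℕ => (m : ℝ))).comp
        (continuous_apply 0)).continuousOn
    refine continuousOn_const.div (h0.add hs) fun a ha => ?_
    have h1 := (cfConv_mem_Icc n (fun i => a (i + 1)) fun i => ha _).1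
    have h2 : (1 : ℝ) ≤ a 0 := by exact_mod_cast ha 0
    exact ne_of_gt (by positivity)

lemma continuousOn_cfVal : ContinuousOn cfVal {a | ∀ i, 1 ≤ a i} := by
  refine TendstoUniformlyOn.continuousOn (F := cfConv) (p := atTop) ?_
    (Eventually.of_forall continuousOn_cfConv).frequently
  rw [Metric.tendstoUniformlyOn_iff]
  intro ε hε
  have h : Tendsto (fun n : ℕ => 2 * (1 / 2 : ℝ) ^ n) atTop (𝓝 0) := by
    simpa using (tendsto_pow_atTop_nhds_zero_of_lt_one (r := (1 / 2 : ℝ)) (by norm_num)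
      (by norm_num)).const_mul 2
  filter_upwards [h.eventually (gt_mem_nhds hε)] with n hn a ha
  rw [dist_comm]
  exact (abs_cfConv_sub_cfVal_le n a ha).trans_lt hn

/-! ### Continued fractions with bounded partial quotients -/

/-- The values of continued fractions with partial quotients in `{1, …, N}`. -/
def boundedCF (N : ℕ) : Set ℝ := cfVal '' {θ | ∀ n, 1 ≤ θ n ∧ θ n ≤ N}

lemma isCompact_boundedCF (N : ℕ) : IsCompact (boundedCF N) := by
  refine IsCompact.image_of_continuousOn ?_ (continuousOn_cfVal.mono fun θ h i => (h i).1)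
  have h : {θ : ℕ → ℕ | ∀ n, 1 ≤ θ n ∧ θ n ≤ N} = Set.pi univ fun _ => Icc 1 N := by
    ext θ
    simp only [mem_ofPred_eq, Set.mem_pi, mem_univ, true_implies, mem_Icc]
  rw [h]
  exact isCompact_univ_pi fun _ => (Set.finite_Icc 1 N).isCompact

lemma nonempty_boundedCF {N : ℕ} (hN : 1 ≤ N) : (boundedCF N).Nonempty :=
  ⟨_, fun _ => 1, fun _ => ⟨le_rfl, hN⟩, rfl⟩

lemma app_nil (θ : ℕ → ℕ) : app [] θ = θ := by
  funext n
  simp [app]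

lemma app_cons_zero (d : ℕ) (w : List ℕ) (θ : ℕ → ℕ) : app (d :: w) θ 0 = d := by
  simp [app]

lemma app_cons_succ (d : ℕ) (w : List ℕ) (θ : ℕ → ℕ) (n : ℕ) :
    app (d :: w) θ (n + 1) = app w θ n := by
  simp [app]

lemma one_le_app {w : List ℕ} {θ : ℕ → ℕ} (hw : ∀ d ∈ w, 1 ≤ d) (hθ : ∀ n, 1 ≤ θ n) (n : ℕ) :
    1 ≤ app w θ n := by
  unfold app
  split
  · exact hw _ (List.get_mem _ _)
  · exact hθ _

lemma cfVal_app_cons {d : ℕ} {w : List ℕ} {θ : ℕ → ℕ} (hd : 1 ≤ d) (hw : ∀ d ∈ w, 1 ≤ d)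
    (hθ : ∀ n, 1 ≤ θ n) : cfVal (app (d :: w) θ) = 1 / (d + cfVal (app w θ)) := by
  rw [cfVal_eq _ (one_le_app (by simpa using ⟨hd, hw⟩) hθ), app_cons_zero]
  simp only [app_cons_succ]

lemma cfVal_app_singleton {d : ℕ} {θ : ℕ → ℕ} (hd : 1 ≤ d) (hθ : ∀ n, 1 ≤ θ n) :
    cfVal (app [d] θ) = 1 / (d + cfVal θ) := by
  rw [cfVal_app_cons hd (by simp) hθ, app_nil]

lemma app_singleton_mem {d N : ℕ} {θ : ℕ → ℕ} (hd : 1 ≤ d ∧ d ≤ N)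
    (hθ : ∀ n, 1 ≤ θ n ∧ θ n ≤ N) (n : ℕ) : 1 ≤ app [d] θ n ∧ app [d] θ n ≤ N := by
  cases n with
  | zero => rwa [app_cons_zero]
  | succ n => rw [app_cons_succ, app_nil]; exact hθ n

lemma one_div_add_mem_boundedCF {N d : ℕ} {x : ℝ} (hx : x ∈ boundedCF N) (hd : 1 ≤ d)
    (hdN : d ≤ N) : 1 / (d + x) ∈ boundedCF N := by
  obtain ⟨θ, hθ, rfl⟩ := hx
  exact ⟨app [d] θ, app_singleton_mem ⟨hd, hdN⟩ hθ, cfVal_app_singleton hd fun n => (hθ n).1⟩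

/-- The values of continued fractions with partial quotients `θ` in `{1, …, N}` such that
`(θ 0, θ 1) ≠ (1, N)`. -/
def restrictedCF (N : ℕ) : Set ℝ :=
  cfVal '' {θ | (∀ n, 1 ≤ θ n ∧ θ n ≤ N) ∧ (θ 0, θ 1) ≠ (1, N)}

lemma one_div_add_mem_restrictedCF {N d : ℕ} {x : ℝ} (hx : x ∈ boundedCF N) (hd : 2 ≤ d)
    (hdN : d ≤ N) : 1 / (d + x) ∈ restrictedCF N := by
  obtain ⟨θ, hθ, rfl⟩ := hx
  refine ⟨app [d] θ, ⟨app_singleton_mem ⟨by omega, hdN⟩ hθ, ?_⟩,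
    cfVal_app_singleton (by omega) fun n => (hθ n).1⟩
  rw [app_cons_zero, Ne, Prod.mk.injEq]
  omega

lemma one_div_one_add_mem_restrictedCF {N d : ℕ} {x : ℝ} (hx : x ∈ boundedCF N) (hd : 1 ≤ d)
    (hdN : d < N) : 1 / (1 + 1 / (d + x)) ∈ restrictedCF N := by
  obtain ⟨θ, hθ, rfl⟩ := hx
  have hd' : ∀ n, 1 ≤ app [d] θ n ∧ app [d] θ n ≤ N := app_singleton_mem ⟨hd, hdN.le⟩ hθ
  refine ⟨app [1] (app [d] θ), ⟨app_singleton_mem ⟨le_rfl, by omega⟩ hd', ?_⟩, ?_⟩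
  · rw [app_cons_zero, app_cons_succ, app_nil, app_cons_zero, Ne, Prod.mk.injEq]
    omega
  · rw [cfVal_app_singleton le_rfl fun n => (hd' n).1,
      cfVal_app_singleton hd fun n => (hθ n).1, Nat.cast_one]

/-! ### Sums of thick Cantor sets -/

/-- `P lo hi g S` is a family of compact sets `S ⊆ [lo, hi]`, closed under cutting `[lo, hi]` at a
gap of length `g` which is at most as long as both of the remaining intervals; the gaps shrink at
least by the factor `c` in each cut, and `hi - lo ≤ C * g`. -/
structure IsThickFamily (c C : ℝ) (P : ℝ → ℝ → ℝ → Set ℝ → Prop) : Prop where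
  isCompact : ∀ {lo hi g S}, P lo hi g S → IsCompact S
  nonempty : ∀ {lo hi g S}, P lo hi g S → S.Nonempty
  subset_Icc : ∀ {lo hi g S}, P lo hi g S → S ⊆ Icc lo hi
  gap_pos : ∀ {lo hi g S}, P lo hi g S → 0 < g
  length_le : ∀ {lo hi g S}, P lo hi g S → hi - lo ≤ C * g
  split : ∀ {lo hi g S}, P lo hi g S → ∃ m g₁ g₂ S₁ S₂, g ≤ m - lo ∧ g ≤ hi - (m + g) ∧
    g₁ ≤ c * g ∧ g₂ ≤ c * g ∧ S₁ ⊆ S ∧ S₂ ⊆ S ∧ P lo m g₁ S₁ ∧ P (m + g) hi g₂ S₂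

namespace IsThickFamily

variable {c C : ℝ} {P : ℝ → ℝ → ℝ → Set ℝ → Prop}

lemma gap_le_length (h : IsThickFamily c C P) {lo hi g : ℝ} {S : Set ℝ} (hS : P lo hi g S) :
    g ≤ hi - lo := by
  obtain ⟨m, _, _, _, _, h1, h2, -⟩ := h.split hS
  linarith [h.gap_pos hS]

lemma exists_abs_add_sub_le (h : IsThickFamily c C P) (hC : 0 ≤ C) (hc0 : 0 ≤ c) (hc : c ≤ 1)
    (n : ℕ) : ∀ {lo₁ hi₁ g₁ S₁ lo₂ hi₂ g₂ S₂ t}, P lo₁ hi₁ g₁ S₁ → P lo₂ hi₂ g₂ S₂ →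
      g₁ ≤ hi₂ - lo₂ → g₂ ≤ hi₁ - lo₁ → t ∈ Icc (lo₁ + lo₂) (hi₁ + hi₂) →
      ∃ a ∈ S₁, ∃ b ∈ S₂, |a + b - t| ≤ C * (g₁ + g₂) * ((1 + c) / 2) ^ n := by
  induction n with
  | zero =>
    intro lo₁ hi₁ g₁ S₁ lo₂ hi₂ g₂ S₂ t h₁ h₂ _ _ ht
    obtain ⟨a, ha⟩ := h.nonempty h₁
    obtain ⟨b, hb⟩ := h.nonempty h₂
    refine ⟨a, ha, b, hb, ?_⟩
    have ha' := h.subset_Icc h₁ ha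
    have hb' := h.subset_Icc h₂ hb
    have hl₁ := h.length_le h₁
    have hl₂ := h.length_le h₂
    rw [abs_le]
    constructor <;> linarith [ha'.1, ha'.2, hb'.1, hb'.2, ht.1, ht.2]
  | succ n ih =>
    intro lo₁ hi₁ g₁ S₁ lo₂ hi₂ g₂ S₂ t h₁ h₂ h₁₂ h₂₁ ht
    wlog hg : g₂ ≤ g₁ generalizing lo₁ hi₁ g₁ S₁ lo₂ hi₂ g₂ S₂
    · obtain ⟨a, ha, b, hb, hab⟩ := this h₂ h₁ h₂₁ h₁₂ (by rwa [add_comm lo₂, add_comm hi₂])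
        (not_le.1 hg).le
      exact ⟨b, hb, a, ha, by rwa [add_comm b, add_comm g₁]⟩
    have bound : ∀ g, g ≤ c * g₁ →
        C * (g + g₂) * ((1 + c) / 2) ^ n ≤ C * (g₁ + g₂) * ((1 + c) / 2) ^ (n + 1) := by
      intro g hg'
      have : g + g₂ ≤ (g₁ + g₂) * ((1 + c) / 2) := by nlinarith
      calc C * (g + g₂) * ((1 + c) / 2) ^ n
          ≤ C * ((g₁ + g₂) * ((1 + c) / 2)) * ((1 + c) / 2) ^ n := by gcongr
        _ = _ := by ring
    obtain ⟨m, g, g', S, S', hm, hm', hgc, hgc', hS, hS', hP, hP'⟩ := h.split h₁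
    have hg₁ := h.gap_pos h₁
    have hcg : c * g₁ ≤ g₁ := mul_le_of_le_one_left hg₁.le hc
    rcases le_total t (m + hi₂) with htm | htm
    · obtain ⟨a, ha, b, hb, hab⟩ := ih hP h₂ (by linarith) (by linarith) ⟨ht.1, htm⟩
      exact ⟨a, hS ha, b, hb, hab.trans (bound g hgc)⟩
    · obtain ⟨a, ha, b, hb, hab⟩ := ih hP' h₂ (by linarith) (by linarith)
        ⟨by linarith, ht.2⟩
      exact ⟨a, hS' ha, b, hb, hab.trans (bound g' hgc')⟩

lemma Icc_subset_add (h : IsThickFamily c C P) (hC : 0 ≤ C) (hc0 : 0 ≤ c) (hc : c < 1)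
    {lo₁ hi₁ g₁ lo₂ hi₂ g₂ : ℝ} {S₁ S₂ : Set ℝ} (h₁ : P lo₁ hi₁ g₁ S₁) (h₂ : P lo₂ hi₂ g₂ S₂)
    (h₁₂ : g₁ ≤ hi₂ - lo₂) (h₂₁ : g₂ ≤ hi₁ - lo₁) :
    Icc (lo₁ + lo₂) (hi₁ + hi₂) ⊆ S₁ + S₂ := by
  intro t ht
  rw [← ((h.isCompact h₁).add (h.isCompact h₂)).isClosed.closure_eq, Metric.mem_closure_iff]
  intro ε hε
  have hlim : Tendsto (fun n : ℕ => C * (g₁ + g₂) * ((1 + c) / 2) ^ n) atTop (𝓝 0) := by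
    simpa using (tendsto_pow_atTop_nhds_zero_of_lt_one (r := (1 + c) / 2) (by linarith)
      (by linarith)).const_mul (C * (g₁ + g₂))
  obtain ⟨n, hn⟩ := (hlim.eventually (gt_mem_nhds hε)).exists
  obtain ⟨a, ha, b, hb, hab⟩ := h.exists_abs_add_sub_le hC hc0 hc.le n h₁ h₂ h₁₂ h₂₁ ht
  refine ⟨a + b, Set.add_mem_add ha hb, ?_⟩
  rw [dist_comm, Real.dist_eq]
  exact hab.trans_lt hn

end IsThickFamily

/-! ### Extremal values -/

/-- `m` and `M` are the extreme values of `boundedCF N`. -/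
structure IsExtremalPair (N : ℕ) (m M : ℝ) : Prop where
  four_le : 4 ≤ N
  max_ge : 0.828 ≤ M
  max_lt : M < 1
  min_pos : 0 < m
  min_le : m ≤ 0.208
  max_mul : M * (1 + m) = 1
  min_mul : m * (N + M) = 1

lemma isExtremalPair {N : ℕ} (hN : 4 ≤ N) :
    IsExtremalPair N ((√((N : ℝ) ^ 2 + 4 * N) - N) / 2 / N) ((√((N : ℝ) ^ 2 + 4 * N) - N) / 2) := by
  have hN' : (4 : ℝ) ≤ N := by exact_mod_cast hN
  have hsq := Real.sq_sqrt (show 0 ≤ (N : ℝ) ^ 2 + 4 * N by positivity)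
  have hpos := Real.sqrt_nonneg ((N : ℝ) ^ 2 + 4 * N)
  set R := √((N : ℝ) ^ 2 + 4 * N)
  obtain ⟨M, hM⟩ : ∃ M, M = (R - N) / 2 := ⟨_, rfl⟩
  rw [← hM]
  have hR : R = N + 2 * M := by linarith
  rw [hR] at hsq hpos
  have hq : M ^ 2 + N * M = N := by linarith
  have h1 : (0.828 : ℝ) ≤ M := by
    by_contra! h
    nlinarith
  have hm : M / N * N = M := by field_simp
  have hm0 : 0 < M / N := by positivity
  have hmul : M / N * (N + M) = 1 := by field_simp; linarith
  exact ⟨hN, h1, by nlinarith, hm0, by nlinarith, by field_simp; linarith, hmul⟩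

namespace IsExtremalPair

variable {N : ℕ} {m M : ℝ}

lemma four_le_cast (h : IsExtremalPair N m M) : (4 : ℝ) ≤ N := by exact_mod_cast h.four_le

lemma max_pos (h : IsExtremalPair N m M) : 0 < M := by linarith [h.max_ge]

lemma one_div_one_add_min (h : IsExtremalPair N m M) : 1 / (1 + m) = M := by
  have := h.min_pos
  rw [div_eq_iff (by positivity), h.max_mul]

lemma one_div_add_max (h : IsExtremalPair N m M) : 1 / (N + M) = m := by
  have := h.max_pos
  rw [div_eq_iff (by positivity), h.min_mul]

lemma boundedCF_subset (h : IsExtremalPair N m M) : boundedCF N ⊆ Icc m M := by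
  have hne := nonempty_boundedCF (show 1 ≤ N by linarith [h.four_le])
  have hN := h.four_le_cast
  obtain ⟨X, hX, hmax⟩ := (isCompact_boundedCF N).exists_isGreatest hne
  obtain ⟨Y, hY, hmin⟩ := (isCompact_boundedCF N).exists_isLeast hne
  have key : ∀ x ∈ boundedCF N, ∃ y ∈ boundedCF N, ∃ d : ℕ, 1 ≤ d ∧ d ≤ N ∧
      x * (d + y) = 1 := by
    rintro _ ⟨θ, hθ, rfl⟩
    have h0 := (cfVal_mem_Icc (fun i => θ (i + 1)) fun i => (hθ _).1).1
    have h1 : (1 : ℝ) ≤ θ 0 := by exact_mod_cast (hθ 0).1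
    refine ⟨_, ⟨_, fun n => hθ (n + 1), rfl⟩, θ 0, (hθ 0).1, (hθ 0).2, ?_⟩
    rw [cfVal_eq θ fun n => (hθ n).1]
    exact one_div_mul_cancel (by positivity)
  have hnonneg : ∀ x ∈ boundedCF N, 0 ≤ x := by
    rintro _ ⟨θ, hθ, rfl⟩
    exact (cfVal_mem_Icc θ fun n => (hθ n).1).1
  have hX0 := hnonneg X hX
  have hY0 := hnonneg Y hY
  have hXY : X * (1 + Y) ≤ 1 := by
    obtain ⟨y, hy, d, hd, -, hxy⟩ := key X hX
    have hd' : (1 : ℝ) ≤ d := by exact_mod_cast hd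
    have := hmin hy
    nlinarith
  have hYX : 1 ≤ Y * (N + X) := by
    obtain ⟨y, hy, d, -, hd, hxy⟩ := key Y hY
    have hd' : (d : ℝ) ≤ N := by exact_mod_cast hd
    have := hmax hy
    nlinarith
  have hM := h.max_pos
  have h0 : X ≤ N * Y := by nlinarith
  have hmM : M = N * m := by linarith [h.max_mul, h.min_mul]
  have hXM : X ≤ M := by
    by_contra! hlt
    have h1 : M * (N + M) = N := by linear_combination (N + M) * hmM + N * h.min_mul
    nlinarith
  have hmY : m ≤ Y := by
    by_contra! hlt
    have := h.min_mul
    have : Y * (N + X) < m * (N + X) := mul_lt_mul_of_pos_right hlt (by linarith)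
    have : m * (N + X) ≤ m * (N + M) := mul_le_mul_of_nonneg_left (by linarith) h.min_pos.le
    linarith
  exact fun x hx => ⟨hmY.trans (hmin hx), (hmax hx).trans hXM⟩

lemma pos_of_mem (h : IsExtremalPair N m M) {x : ℝ} (hx : x ∈ boundedCF N) : 0 < x :=
  h.min_pos.trans_le (h.boundedCF_subset hx).1

end IsExtremalPair

/-! ### Blocks of cylinders -/

/-- A Möbius transformation with pole at `-r`. -/
def moebius (A T r y : ℝ) : ℝ := A - T / (y + r)

/-- `S` is the image under a Möbius transformation of the numbers `d + [0; θ]` with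
`i ≤ d ≤ j` and `θ n ∈ {1, …, N}`; its extreme points are `u` and `v`, with `u < v` if `σ = 1` and
`v < u` if `σ = -1`, and `g` is the length of the gap between the parts `d = i` and `d > i`. -/
def IsBlock (N : ℕ) (m M σ u v g : ℝ) (S : Set ℝ) : Prop :=
  ∃ (A T r : ℝ) (i j : ℕ), 0 < T ∧ 0 ≤ r ∧ r ≤ 1 ∧ 1 ≤ i ∧ i < j ∧ j ≤ N ∧
    u = moebius A (σ * T) r (i + m) ∧ v = moebius A (σ * T) r (j + M) ∧
    g = T * (1 + m - M) / ((i + M + r) * (i + 1 + m + r)) ∧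
    S = {x | ∃ d : ℕ, ∃ e ∈ boundedCF N, i ≤ d ∧ d ≤ j ∧ x = moebius A (σ * T) r (d + e)}

/-- `S` is a block with convex hull `[lo, hi]` and first gap of length `g`. -/
def IsOrderedBlock (N : ℕ) (m M lo hi g : ℝ) (S : Set ℝ) : Prop :=
  IsBlock N m M 1 lo hi g S ∨ IsBlock N m M (-1) hi lo g S

lemma moebius_add_one_div {A s u z r n : ℝ} (hu : u = n + r) (hu0 : 0 < u) (hz : 0 < z) :
    moebius (A - s / u) (-(s / u ^ 2)) (1 / u) z = moebius A s r (n + 1 / z) := by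
  have h1 : n + 1 / z + r = u + 1 / z := by rw [hu]; ring
  unfold moebius
  rw [h1]
  have : z + 1 / u ≠ 0 := by positivity
  have : u + 1 / z ≠ 0 := by positivity
  have : u * z + 1 ≠ 0 := by positivity
  field_simp
  ring

lemma div_sub_div_eq {T x y : ℝ} (hx : 0 < x) (hy : 0 < y) :
    T / x - T / y = T * (y - x) / (x * y) := by
  field_simp

lemma mul_div_le_mul_div {T a b x y : ℝ} (hT : 0 < T) (hx : 0 < x) (hy : 0 < y)
    (h : a * y ≤ b * x) : T * a / x ≤ T * b / y := by
  rw [div_le_div_iff₀ hx hy]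
  nlinarith

lemma isBlock_append {N : ℕ} {m M σ A T r : ℝ} {n i j : ℕ} (h : IsExtremalPair N m M) (hT : 0 < T)
    (hr : 0 ≤ r) (hn : 1 ≤ n) (hi : 1 ≤ i) (hij : i < j) (hj : j ≤ N) :
    IsBlock N m M (-σ) (moebius A (σ * T) r (n + 1 / (i + m))) (moebius A (σ * T) r (n + 1 / (j + M)))
      (T * (1 + m - M) / (((n + r) * (i + M) + 1) * ((n + r) * (i + 1 + m) + 1)))
      {x | ∃ d : ℕ, ∃ e ∈ boundedCF N, i ≤ d ∧ d ≤ j ∧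
        x = moebius A (σ * T) r (n + 1 / (d + e))} := by
  have hn' : (1 : ℝ) ≤ n := by exact_mod_cast hn
  have hi' : (1 : ℝ) ≤ i := by exact_mod_cast hi
  have hm := h.min_pos
  have hM := h.max_pos
  obtain ⟨u, hu⟩ : ∃ u : ℝ, u = n + r := ⟨_, rfl⟩
  have hu0 : 0 < u := by rw [hu]; positivity
  have key : ∀ z : ℝ, 0 < z → moebius A (σ * T) r (n + 1 / z)
      = moebius (A - σ * T / u) (-σ * (T / u ^ 2)) (1 / u) z := fun z hz => by
    rw [← moebius_add_one_div hu hu0 hz]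
    congr 1
    ring
  refine ⟨A - σ * T / u, T / u ^ 2, 1 / u, i, j, by positivity, by positivity, ?_, hi, hij, hj,
    key _ (by positivity), key _ (by positivity), ?_, ?_⟩
  · rw [div_le_one hu0]
    linarith
  · rw [← hu]
    have : i + M + 1 / u ≠ 0 := by positivity
    have : i + 1 + m + 1 / u ≠ 0 := by positivity
    have : u * (i + M) + 1 ≠ 0 := by positivity
    have : u * (i + 1 + m) + 1 ≠ 0 := by positivity
    field_simp
  · ext x
    constructor <;> rintro ⟨d, e, he, hd, hdj, rfl⟩ <;> refine ⟨d, e, he, hd, hdj, ?_⟩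
    · exact key _ (by have := h.pos_of_mem he; positivity)
    · exact (key _ (by have := h.pos_of_mem he; positivity)).symm

lemma isBlock_cylinder {N : ℕ} {m M σ A T r : ℝ} {n : ℕ} (h : IsExtremalPair N m M) (hT : 0 < T)
    (hr : 0 ≤ r) (hn : 1 ≤ n) :
    IsBlock N m M (-σ) (moebius A (σ * T) r (n + M)) (moebius A (σ * T) r (n + m))
      (T * (1 + m - M) / (((n + r) * (1 + M) + 1) * ((n + r) * (2 + m) + 1)))
      {x | ∃ d : ℕ, ∃ e ∈ boundedCF N, 1 ≤ d ∧ d ≤ N ∧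
        x = moebius A (σ * T) r (n + 1 / (d + e))} := by
  have := isBlock_append (σ := σ) (A := A) h hT hr hn le_rfl
    (show 1 < N by linarith [h.four_le]) le_rfl
  rwa [Nat.cast_one, h.one_div_one_add_min, h.one_div_add_max, one_add_one_eq_two] at this

lemma IsBlock.split {N : ℕ} {m M σ u v g : ℝ} {S : Set ℝ} (h : IsExtremalPair N m M)
    (hσ : σ * σ = 1) (hS : IsBlock N m M σ u v g S) :
    ∃ u' v' g₁ g₂ S₁ S₂, g = σ * (v' - u') ∧ g ≤ σ * (u' - u) ∧ g ≤ σ * (v - v') ∧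
      g₁ ≤ (N + 2) / (N + 3) * g ∧ g₂ ≤ (N + 2) / (N + 3) * g ∧ S₁ ⊆ S ∧ S₂ ⊆ S ∧
      IsBlock N m M (-σ) u' u g₁ S₁ ∧
      (IsBlock N m M σ v' v g₂ S₂ ∨ IsBlock N m M (-σ) v v' g₂ S₂) := by
  obtain ⟨A, T, r, i, j, hT, hr, hr1, hi, hij, hj, rfl, rfl, rfl, rfl⟩ := hS
  have hm := h.min_pos
  have hm' := h.min_le
  have hM := h.max_ge
  have hM' := h.max_lt
  have hi' : (1 : ℝ) ≤ i := by exact_mod_cast hi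
  have hij' : (i : ℝ) + 1 ≤ j := by exact_mod_cast hij
  have hj' : (j : ℝ) ≤ N := by exact_mod_cast hj
  have hgap : 0 < 1 + m - M := by linarith
  have hdiff : ∀ x y : ℝ, 0 < x + r → 0 < y + r → σ * (moebius A (σ * T) r y - moebius A (σ * T) r x)
      = T * (y - x) / ((x + r) * (y + r)) := by
    intro x y hx hy
    have := div_sub_div_eq (T := T) hx hy
    rw [add_sub_add_right_eq_sub] at this
    rw [← this]
    unfold moebius
    linear_combination (T / (x + r) - T / (y + r)) * hσ
  have hc : ∀ t : ℝ, t ≤ N + 2 → t * (N + 3) ≤ (N + 2) * (t + 1) := fun t ht => by linarith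
  have hgap' : ∀ x y : ℝ, (i + M + r) * (N + 3) ≤ (N + 2) * x → i + 1 + m + r ≤ y →
      T * (1 + m - M) / (x * y)
        ≤ (N + 2) / (N + 3) * (T * (1 + m - M) / ((i + M + r) * (i + 1 + m + r))) := by
    intro x y hx hy
    have hx0 : 0 < x := by
      by_contra! hneg
      have : 0 < (i + M + r) * ((N : ℝ) + 3) := by positivity
      nlinarith
    have hy0 : 0 < y := lt_of_lt_of_le (by positivity) hy
    rw [div_mul_div_comm, div_le_div_iff₀ (by positivity) (by positivity)]
    calc T * (1 + m - M) * ((N + 3) * ((i + M + r) * (i + 1 + m + r)))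
        = T * (1 + m - M) * (((i + M + r) * (N + 3)) * (i + 1 + m + r)) := by ring
      _ ≤ T * (1 + m - M) * (((N + 2) * x) * y) := by gcongr
      _ = _ := by ring
  have hcyl : ∀ n : ℕ, i ≤ n → n ≤ N →
      T * (1 + m - M) / (((n + r) * (1 + M) + 1) * ((n + r) * (2 + m) + 1))
        ≤ (N + 2) / (N + 3) * (T * (1 + m - M) / ((i + M + r) * (i + 1 + m + r))) := by
    intro n hn hnN
    have hn' : (i : ℝ) ≤ n := by exact_mod_cast hn
    refine hgap' _ _ ?_ (by nlinarith)
    refine (hc _ (by linarith)).trans (mul_le_mul_of_nonneg_left ?_ (by positivity))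
    nlinarith
  have htail : ∃ g₂ S₂, g₂ ≤ (N + 2) / (N + 3) * (T * (1 + m - M) / ((i + M + r) * (i + 1 + m + r))) ∧
      S₂ ⊆ {x | ∃ d : ℕ, ∃ e ∈ boundedCF N, i ≤ d ∧ d ≤ j ∧ x = moebius A (σ * T) r (d + e)} ∧
      (IsBlock N m M σ (moebius A (σ * T) r (i + 1 + m)) (moebius A (σ * T) r (j + M)) g₂ S₂ ∨
        IsBlock N m M (-σ) (moebius A (σ * T) r (j + M)) (moebius A (σ * T) r (i + 1 + m)) g₂ S₂) := by
    rcases Nat.lt_or_ge (i + 1) j with hlt | hge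
    · refine ⟨_, _, ?_, ?_, Or.inl ⟨A, T, r, i + 1, j, hT, hr, hr1, by omega, hlt, hj, by push_cast; rfl,
        rfl, rfl, rfl⟩⟩
      · push_cast
        refine hgap' _ _ ((hc _ (by linarith)).trans (le_of_eq (by ring))) (by linarith)
      · rintro x ⟨d, e, he, hd, hdj, rfl⟩
        exact ⟨d, e, he, by omega, hdj, rfl⟩
    · obtain rfl : j = i + 1 := by omega
      have := isBlock_cylinder (σ := σ) (A := A) (n := i + 1) h hT hr (by omega)
      push_cast at this ⊢
      refine ⟨_, _, ?_, ?_, Or.inr this⟩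
      · simpa using hcyl (i + 1) (by omega) hj
      · rintro x ⟨d, e, he, hd, hdj, rfl⟩
        exact ⟨i + 1, _, one_div_add_mem_boundedCF he hd hdj, by omega, le_rfl, by push_cast; rfl⟩
  obtain ⟨g₂, S₂, hg₂, hS₂, hB⟩ := htail
  refine ⟨moebius A (σ * T) r (i + M), moebius A (σ * T) r (i + 1 + m), _, g₂, _, S₂, ?_, ?_, ?_,
    hcyl i le_rfl (by omega), hg₂, ?_, hS₂, isBlock_cylinder h hT hr hi, hB⟩
  · rw [hdiff _ _ (by positivity) (by positivity)]
    congr 2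
    ring
  · rw [hdiff _ _ (by positivity) (by positivity)]
    refine mul_div_le_mul_div hT (by positivity) (by positivity) ?_
    nlinarith [mul_pos (show 0 < i + M + r by positivity) (show 0 < i + m + r by positivity)]
  · rw [hdiff _ _ (by positivity) (by positivity)]
    refine mul_div_le_mul_div hT (by positivity) (by positivity) ?_
    have key : (1 + m - M) * (j + M + r) ≤ (j + M - (i + 1 + m)) * (i + M + r) := by
      have h1 : 0 ≤ ((j : ℝ) - i - 1) * (i + M + r - (1 + m - M)) :=
        mul_nonneg (by linarith) (by linarith)
      have h2 : (1 + m - M) * (i + 1 + M + r) ≤ (M - m) * (i + M + r) := by nlinarith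
      nlinarith
    have := mul_le_mul_of_nonneg_right key (show 0 ≤ i + 1 + m + r by positivity)
    linarith
  · rintro x ⟨d, e, he, hd, hdj, rfl⟩
    exact ⟨i, _, one_div_add_mem_boundedCF he hd hdj, le_rfl, hij.le, rfl⟩

lemma IsBlock.isCompact {N : ℕ} {m M σ u v g : ℝ} {S : Set ℝ} (h : IsExtremalPair N m M)
    (hS : IsBlock N m M σ u v g S) : IsCompact S := by
  obtain ⟨A, T, r, i, j, hT, hr, hr1, hi, hij, hj, rfl, rfl, rfl, rfl⟩ := hS
  have heq : {x | ∃ d : ℕ, ∃ e ∈ boundedCF N, i ≤ d ∧ d ≤ j ∧ x = moebius A (σ * T) r (d + e)}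
      = ⋃ d ∈ Icc i j, (fun e : ℝ => A - σ * T / (d + e + r)) '' boundedCF N := by
    ext x
    simp only [mem_iUnion, mem_Icc, mem_image, moebius, exists_prop]
    constructor
    · rintro ⟨d, e, he, hd, hdj, rfl⟩
      exact ⟨d, ⟨hd, hdj⟩, e, he, rfl⟩
    · rintro ⟨d, ⟨hd, hdj⟩, e, he, rfl⟩
      exact ⟨d, e, he, hd, hdj, rfl⟩
  rw [heq]
  refine (Set.finite_Icc i j).isCompact_biUnion fun d _ => ?_
  refine (isCompact_boundedCF N).image_of_continuousOn ?_
  refine continuousOn_const.sub (continuousOn_const.div (by fun_prop) fun e he => ?_)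
  have := h.pos_of_mem he
  positivity

lemma IsBlock.nonempty {N : ℕ} {m M σ u v g : ℝ} {S : Set ℝ} (hS : IsBlock N m M σ u v g S) : S.Nonempty := by
  obtain ⟨A, T, r, i, j, hT, hr, hr1, hi, hij, hj, rfl, rfl, rfl, rfl⟩ := hS
  obtain ⟨e, he⟩ := nonempty_boundedCF (show 1 ≤ N by omega)
  exact ⟨_, i, e, he, le_rfl, hij.le, rfl⟩

lemma IsBlock.gap_pos {N : ℕ} {m M σ u v g : ℝ} {S : Set ℝ} (h : IsExtremalPair N m M)
    (hS : IsBlock N m M σ u v g S) : 0 < g := by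
  obtain ⟨A, T, r, i, j, hT, hr, hr1, hi, hij, hj, rfl, rfl, rfl, rfl⟩ := hS
  have := h.min_pos
  have := h.max_pos
  have : 0 < 1 + m - M := by linarith [h.max_lt]
  positivity

lemma IsBlock.mem_bounds {N : ℕ} {m M σ u v g x : ℝ} {S : Set ℝ} (h : IsExtremalPair N m M)
    (hσ : σ * σ = 1) (hS : IsBlock N m M σ u v g S) (hx : x ∈ S) :
    0 ≤ σ * (x - u) ∧ 0 ≤ σ * (v - x) := by
  obtain ⟨A, T, r, i, j, hT, hr, hr1, hi, hij, hj, rfl, rfl, rfl, rfl⟩ := hS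
  obtain ⟨d, e, he, hd, hdj, rfl⟩ := hx
  obtain ⟨he1, he2⟩ := h.boundedCF_subset he
  have he0 := h.pos_of_mem he
  have hm := h.min_pos
  have hd' : (i : ℝ) ≤ d := by exact_mod_cast hd
  have hdj' : (d : ℝ) ≤ j := by exact_mod_cast hdj
  have hi' : (1 : ℝ) ≤ i := by exact_mod_cast hi
  have h1 : T / (d + e + r) ≤ T / (i + m + r) := by gcongr
  have h2 : T / (j + M + r) ≤ T / (d + e + r) := by gcongr
  unfold moebius
  constructor
  · linear_combination h1 + (T / (d + e + r) - T / (i + m + r)) * hσ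
  · linear_combination h2 + (T / (j + M + r) - T / (d + e + r)) * hσ

lemma IsBlock.length_le {N : ℕ} {m M σ u v g : ℝ} {S : Set ℝ} (h : IsExtremalPair N m M)
    (hσ : σ * σ = 1) (hS : IsBlock N m M σ u v g S) :
    σ * (v - u) ≤ 2 * (N + 2) / (1 + m - M) * g := by
  obtain ⟨A, T, r, i, j, hT, hr, hr1, hi, hij, hj, rfl, rfl, rfl, rfl⟩ := hS
  have hm := h.min_pos
  have hM := h.max_pos
  have hM' := h.max_lt
  have hgap : 0 < 1 + m - M := by linarith
  have hi' : (1 : ℝ) ≤ i := by exact_mod_cast hi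
  have hij' : (i : ℝ) + 1 ≤ j := by exact_mod_cast hij
  have hj' : (j : ℝ) ≤ N := by exact_mod_cast hj
  have h1 : T / (i + m + r)
      ≤ 2 * (N + 2) / (1 + m - M) * (T * (1 + m - M) / ((i + M + r) * (i + 1 + m + r))) := by
    have : 2 * (N + 2) / (1 + m - M) * (T * (1 + m - M) / ((i + M + r) * (i + 1 + m + r)))
        = T * (2 * (N + 2)) / ((i + M + r) * (i + 1 + m + r)) := by
      field_simp
    rw [this, ← mul_one T, mul_assoc T 1]
    refine mul_div_le_mul_div hT (by positivity) (by positivity) ?_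
    have h2 : i + M + r ≤ N + 2 := by linarith
    have h3 : i + 1 + m + r ≤ 2 * (i + m + r) := by linarith
    have := mul_le_mul h2 h3 (by positivity) (by positivity)
    linarith
  have h2 : 0 < T / (j + M + r) := by positivity
  unfold moebius
  linear_combination h1 + h2 + (T / (i + m + r) - T / (j + M + r)) * hσ

lemma isThickFamily_isOrderedBlock {N : ℕ} {m M : ℝ} (h : IsExtremalPair N m M) :
    IsThickFamily ((N + 2) / (N + 3)) (2 * (N + 2) / (1 + m - M)) (IsOrderedBlock N m M) where
  isCompact := by rintro lo hi g S (hS | hS) <;> exact hS.isCompact h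
  nonempty := by rintro lo hi g S (hS | hS) <;> exact hS.nonempty
  gap_pos := by rintro lo hi g S (hS | hS) <;> exact hS.gap_pos h
  subset_Icc := by
    rintro lo hi g S (hS | hS) x hx <;>
      obtain ⟨h1, h2⟩ := hS.mem_bounds h (by norm_num) hx <;>
      constructor <;> linarith
  length_le := by
    rintro lo hi g S (hS | hS) <;> have := hS.length_le h (by norm_num) <;> linarith
  split := by
    rintro lo hi g S (hS | hS) <;>
      obtain ⟨u, v, g₁, g₂, S₁, S₂, hg, h1, h2, hg₁, hg₂, hS₁, hS₂, hB₁, hB₂⟩ :=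
        hS.split h (by norm_num)
    · obtain rfl : v = u + g := by linarith
      exact ⟨u, g₁, g₂, S₁, S₂, by linarith, by linarith, hg₁, hg₂, hS₁, hS₂, Or.inr hB₁, hB₂⟩
    · obtain rfl : u = v + g := by linarith
      rw [neg_neg] at hB₁ hB₂
      exact ⟨v, g₂, g₁, S₂, S₁, by linarith, by linarith, hg₂, hg₁, hS₂, hS₁, hB₂.symm, Or.inl hB₁⟩

/-! ### One level of the covering -/

lemma moebius_sub {A T r x y : ℝ} (hx : 0 < x + r) (hy : 0 < y + r) :
    moebius A T r y - moebius A T r x = T * (y - x) / ((x + r) * (y + r)) := by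
  rw [← add_sub_add_right_eq_sub y x r, ← div_sub_div_eq hx hy]
  unfold moebius
  ring

section Level

variable {N : ℕ} {m M A T r : ℝ}

lemma isOrderedBlock_cylinder (h : IsExtremalPair N m M) (hT : 0 < T) (hr : 0 ≤ r) {n : ℕ}
    (hn : 1 ≤ n) : ∃ S, S ⊆ (fun x => moebius A T r (n + x)) '' boundedCF N ∧
      IsOrderedBlock N m M (moebius A T r (n + m)) (moebius A T r (n + M))
        (T * (1 + m - M) / (((n + r) * (1 + M) + 1) * ((n + r) * (2 + m) + 1))) S := by
  have := isBlock_cylinder (σ := 1) (A := A) h hT hr hn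
  simp only [one_mul] at this
  refine ⟨_, ?_, Or.inr this⟩
  rintro x ⟨d, e, he, hd, hdN, rfl⟩
  exact ⟨_, one_div_add_mem_boundedCF he hd hdN, rfl⟩

lemma isOrderedBlock_two_le (h : IsExtremalPair N m M) (hT : 0 < T) (hr : 0 ≤ r) {n : ℕ}
    (hn : 1 ≤ n) : ∃ S, S ⊆ (fun x => moebius A T r (n + x)) '' restrictedCF N ∧
      IsOrderedBlock N m M (moebius A T r (n + m)) (moebius A T r (n + 1 / (2 + m)))
        (T * (1 + m - M) / (((n + r) * (2 + M) + 1) * ((n + r) * (3 + m) + 1))) S := by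
  have := isBlock_append (σ := 1) (A := A) h hT hr hn one_le_two
    (show 2 < N by linarith [h.four_le]) le_rfl
  simp only [one_mul, h.one_div_add_max, Nat.cast_ofNat] at this
  rw [two_add_one_eq_three] at this
  refine ⟨_, ?_, Or.inr this⟩
  rintro x ⟨d, e, he, hd, hdN, rfl⟩
  exact ⟨_, one_div_add_mem_restrictedCF he hd hdN, rfl⟩

lemma isOrderedBlock_one_lt (h : IsExtremalPair N m M) (hT : 0 < T) (hr : 0 ≤ r) {n : ℕ}
    (hn : 1 ≤ n) : ∃ S, S ⊆ (fun x => moebius A T r (n + x)) '' restrictedCF N ∧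
      IsOrderedBlock N m M (moebius A T r (n + 1 / (1 + M)))
        (moebius A T r (n + 1 / (1 + 1 / (N - 1 + M))))
        (T * (1 + m - M) /
          (((n + r) * (2 + M) + 1 + M) * ((n + r) * (3 + m) + 2 + m))) S := by
  have hn' : (1 : ℝ) ≤ n := by exact_mod_cast hn
  have hN := h.four_le_cast
  have hm := h.min_pos
  have hM := h.max_pos
  obtain ⟨u, hu⟩ : ∃ u : ℝ, u = n + r := ⟨_, rfl⟩
  have hu0 : 0 < u := by rw [hu]; positivity
  have := isBlock_append (σ := -1) (A := A - T / u) (T := T / u ^ 2) (r := 1 / u) h (by positivity)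
    (by positivity) le_rfl le_rfl (show 1 < N - 1 by have := h.four_le; omega) (Nat.sub_le N 1)
  have hN1 : ((N - 1 : ℕ) : ℝ) = N - 1 := by
    rw [Nat.cast_sub (by linarith [h.four_le]), Nat.cast_one]
  have hpos : (0 : ℝ) < N - 1 + M := by linarith
  simp only [neg_neg, neg_one_mul, Nat.cast_one, hN1, h.one_div_one_add_min] at this
  rw [moebius_add_one_div hu hu0 (by positivity), moebius_add_one_div hu hu0 (by positivity)] at this
  have hg : T / u ^ 2 * (1 + m - M) / (((1 + 1 / u) * (1 + M) + 1) * ((1 + 1 / u) * (1 + 1 + m) + 1))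
      = T * (1 + m - M) / ((u * (2 + M) + 1 + M) * (u * (3 + m) + 2 + m)) := by
    have : (1 + 1 / u) * (1 + M) + 1 ≠ 0 := by positivity
    have : (1 + 1 / u) * (1 + 1 + m) + 1 ≠ 0 := by positivity
    have h1 : (1 + 1 / u) * (1 + M) + 1 = (u * (2 + M) + 1 + M) / u := by field_simp; ring
    have h2 : (1 + 1 / u) * (1 + 1 + m) + 1 = (u * (3 + m) + 2 + m) / u := by field_simp; ring
    rw [h1, h2]
    field_simp
  rw [hg] at this
  rw [← hu]
  refine ⟨_, ?_, Or.inl this⟩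
  rintro x ⟨d, e, he, hd, hdN, rfl⟩
  refine ⟨_, one_div_one_add_mem_restrictedCF he hd (by omega), ?_⟩
  have := h.pos_of_mem he
  exact (moebius_add_one_div hu hu0 (by positivity)).symm

lemma Icc_subset_add_of_isOrderedBlock (h : IsExtremalPair N m M)
    {lo₁ hi₁ g₁ lo₂ hi₂ g₂ : ℝ} {S₁ S₂ : Set ℝ} (h₁ : IsOrderedBlock N m M lo₁ hi₁ g₁ S₁)
    (h₂ : IsOrderedBlock N m M lo₂ hi₂ g₂ S₂) (h₁₂ : g₁ ≤ hi₂ - lo₂) (h₂₁ : g₂ ≤ hi₁ - lo₁) :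
    Icc (lo₁ + lo₂) (hi₁ + hi₂) ⊆ S₁ + S₂ := by
  have : 0 < 1 + m - M := by linarith [h.max_lt, h.min_pos]
  exact (isThickFamily_isOrderedBlock h).Icc_subset_add (by positivity) (by positivity)
    (by rw [div_lt_one (by positivity)]; linarith) h₁ h₂ h₁₂ h₂₁

lemma Icc_subset_add_union_add (h : IsExtremalPair N m M) (hT : 0 < T) (hr : 0 ≤ r) :
    Icc (2 * moebius A T r (N + M)) (2 * moebius A T r ((N + 1 : ℕ) + M)) ⊆
      ((fun x => moebius A T r ((N + 1 : ℕ) + x)) '' restrictedCF N +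
          (fun x => moebius A T r (N + x)) '' boundedCF N) ∪
        ((fun x => moebius A T r ((N + 1 : ℕ) + x)) '' boundedCF N +
          (fun x => moebius A T r ((N + 1 : ℕ) + x)) '' boundedCF N) := by
  have hN := h.four_le_cast
  have hm := h.min_pos
  have hm' := h.min_le
  have hM := h.max_ge
  have hM' := h.max_lt
  obtain ⟨S, hS, hB⟩ := isOrderedBlock_cylinder (A := A) h hT hr (show 1 ≤ N + 1 by omega)
  obtain ⟨Sγ, hSγ, hBγ⟩ := isOrderedBlock_cylinder (A := A) h hT hr
    (show 1 ≤ N by linarith [h.four_le])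
  obtain ⟨S₁, hS₁, hB₁⟩ := isOrderedBlock_two_le (A := A) h hT hr (show 1 ≤ N + 1 by omega)
  obtain ⟨S₂, hS₂, hB₂⟩ := isOrderedBlock_one_lt (A := A) h hT hr (show 1 ≤ N + 1 by omega)
  obtain ⟨p, hp⟩ : ∃ p, p = 1 / (2 + m) := ⟨_, rfl⟩
  obtain ⟨q, hq⟩ : ∃ q, q = 1 / (1 + M) := ⟨_, rfl⟩
  obtain ⟨s, hs⟩ : ∃ s, s = 1 / (1 + 1 / (N - 1 + M)) := ⟨_, rfl⟩
  have hp1 : 0.452 ≤ p := by rw [hp, le_div_iff₀ (by positivity)]; linarith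
  have hp2 : p ≤ 0.5 := by rw [hp, div_le_iff₀ (by positivity)]; linarith
  have hq1 : 0.5 ≤ q := by rw [hq, le_div_iff₀ (by positivity)]; linarith
  have hq2 : q ≤ 0.548 := by rw [hq, div_le_iff₀ (by positivity)]; linarith
  have hs1 : 0.792 ≤ s := by
    have h1 : 1 / (N - 1 + M) ≤ 1 / 3.828 :=
      one_div_le_one_div_of_le (by norm_num) (by linarith)
    have h2 : 0 < 1 / (N - 1 + M) := one_div_pos.2 (by linarith)
    rw [hs, le_div_iff₀ (by positivity)]
    norm_num at h1 ⊢
    linarith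
  have hs2 : s ≤ 1 := by
    have h2 : 0 < 1 / (N - 1 + M) := one_div_pos.2 (by linarith)
    rw [hs, div_le_one (by positivity)]
    linarith
  rw [← hp] at hB₁
  rw [← hq, ← hs] at hB₂
  clear hp hq hs
  push_cast at hB hB₁ hB₂ hS hS₁ hS₂ ⊢
  obtain ⟨u, hu⟩ : ∃ u : ℝ, u = N + r := ⟨_, rfl⟩
  have hu4 : 4 ≤ u := by linarith
  have hsub : ∀ x y : ℝ, 0 < x → 0 < y → moebius A T r (N + y) - moebius A T r (N + x)
      = T * (y - x) / ((u + x) * (u + y)) := by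
    intro x y hx hy
    rw [moebius_sub (by positivity) (by positivity), hu]
    congr 1 <;> ring
  have hgap : 0 < 1 + m - M := by linarith
  have hself := Icc_subset_add_of_isOrderedBlock h hB hB
    ((isThickFamily_isOrderedBlock h).gap_le_length hB)
    ((isThickFamily_isOrderedBlock h).gap_le_length hB)
  simp only [add_assoc (N : ℝ) 1] at *
  have hu1 : N + (1 + r) = u + 1 := by rw [hu]; ring
  have hδ : 1 + m - M ≤ 0.38 := by linarith
  have hδ' : 0.62 ≤ M - m := by linarith
  rw [hu1] at hB hB₁ hB₂
  rw [← hu] at hBγ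
  have hlow := Icc_subset_add_of_isOrderedBlock h hB₁ hBγ
    (by
      rw [hsub _ _ (by positivity) (by positivity)]
      refine mul_div_le_mul_div hT (by positivity) (by positivity) ?_
      calc _ ≤ (0.38 : ℝ) * ((u + 1) * (u + 1)) := by gcongr; linarith
        _ ≤ 0.62 * (((u + 1) * 2 + 1) * ((u + 1) * 3 + 1)) := by nlinarith
        _ ≤ _ := by gcongr <;> linarith)
    (by
      rw [hsub _ _ (by positivity) (by positivity)]
      refine mul_div_le_mul_div hT (by positivity) (by positivity) ?_
      calc _ ≤ (0.38 : ℝ) * ((u + 1.208) * (u + 1.5)) := by gcongr <;> linarith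
        _ ≤ 0.244 * ((u * 1.828 + 1) * (u * 2 + 1)) := by nlinarith
        _ ≤ _ := by gcongr <;> linarith)
  have hhigh := Icc_subset_add_of_isOrderedBlock h hB₂ hBγ
    (by
      rw [hsub _ _ (by positivity) (by positivity)]
      refine mul_div_le_mul_div hT (by positivity) (by positivity) ?_
      calc _ ≤ (0.38 : ℝ) * ((u + 1) * (u + 1)) := by gcongr; linarith
        _ ≤ 0.62 * (((u + 1) * 2 + 1 + 0) * ((u + 1) * 3 + 2 + 0)) := by nlinarith
        _ ≤ _ := by gcongr <;> linarith)
    (by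
      rw [hsub _ _ (by positivity) (by positivity)]
      refine mul_div_le_mul_div hT (by positivity) (by positivity) ?_
      calc _ ≤ (0.38 : ℝ) * ((u + 1.548) * (u + 2)) := by gcongr <;> linarith
        _ ≤ 0.244 * ((u * 1.828 + 1) * (u * 2 + 1)) := by nlinarith
        _ ≤ _ := by gcongr <;> linarith)
  have hstart : moebius A T r (N + (1 + m)) - moebius A T r (N + M)
      ≤ moebius A T r (N + M) - moebius A T r (N + m) := by
    rw [hsub _ _ (by positivity) (by positivity), hsub _ _ (by positivity) (by positivity)]
    refine mul_div_le_mul_div hT (by positivity) (by positivity) ?_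
    calc _ ≤ (0.38 : ℝ) * ((u + 0.208) * (u + 1)) := by gcongr
      _ ≤ 0.62 * ((u + 0.828) * (u + 1)) := by nlinarith
      _ ≤ _ := by gcongr; linarith
  have hmid : moebius A T r (N + (1 + q)) - moebius A T r (N + (1 + p))
      ≤ moebius A T r (N + M) - moebius A T r (N + m) := by
    rw [hsub _ _ (by positivity) (by positivity), hsub _ _ (by positivity) (by positivity)]
    refine mul_div_le_mul_div hT (by positivity) (by positivity) ?_
    calc _ ≤ (0.096 : ℝ) * ((u + 0.208) * (u + 1)) := by gcongr; linarith
      _ ≤ 0.62 * ((u + 1.452) * (u + 1.5)) := by nlinarith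
      _ ≤ _ := by gcongr <;> linarith
  have hend : moebius A T r (N + (1 + m)) - moebius A T r (N + M)
      ≤ moebius A T r (N + (1 + s)) - moebius A T r (N + (1 + m)) := by
    rw [hsub _ _ (by positivity) (by positivity), hsub _ _ (by positivity) (by positivity)]
    refine mul_div_le_mul_div hT (by positivity) (by positivity) ?_
    calc _ ≤ (0.38 : ℝ) * ((u + 1.208) * (u + 2)) := by gcongr <;> linarith
      _ ≤ 0.584 * ((u + 0.828) * (u + 1)) := by nlinarith
      _ ≤ _ := by gcongr <;> linarith
  intro t ht
  rcases le_total (2 * moebius A T r (N + (1 + m))) t with h2 | h2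
  · exact Or.inr (Set.add_subset_add hS hS (hself ⟨by linarith, by linarith [ht.2]⟩))
  rcases le_total t (moebius A T r (N + (1 + p)) + moebius A T r (N + M)) with h1 | h1
  · exact Or.inl (Set.add_subset_add hS₁ hSγ (hlow ⟨by linarith [ht.1], h1⟩))
  · exact Or.inl (Set.add_subset_add hS₂ hSγ (hhigh ⟨by linarith, by linarith⟩))

end Level

/-! ### The words `β^s` and `γ^s` -/

/-- The action of the word `1, k` on tails. -/
def betaMap (k : ℕ) (x : ℝ) : ℝ := 1 / (1 + 1 / (k + x))

lemma betaW_succ (k s : ℕ) : betaW k (s + 1) = betaW k s ++ [1, k] := by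
  simp [betaW, List.replicate_succ']

lemma cfVal_app_betaW_append {k : ℕ} (hk : 1 ≤ k) (s : ℕ) {w : List ℕ} (hw : ∀ d ∈ w, 1 ≤ d)
    {θ : ℕ → ℕ} (hθ : ∀ n, 1 ≤ θ n) :
    cfVal (app (betaW k s ++ w) θ) = (betaMap k)^[s] (cfVal (app w θ)) := by
  induction s generalizing w with
  | zero => simp [betaW]
  | succ s ih =>
    have hkw : ∀ d ∈ k :: w, 1 ≤ d := by simpa using ⟨hk, hw⟩
    have h1kw : ∀ d ∈ 1 :: k :: w, 1 ≤ d := by simpa using ⟨hk, hw⟩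
    rw [betaW_succ, List.append_assoc, Function.iterate_succ_apply]
    simp only [List.cons_append, List.nil_append]
    rw [ih h1kw, cfVal_app_cons le_rfl hkw hθ, cfVal_app_cons hk hw hθ, Nat.cast_one]
    rfl

lemma cfVal_app_betaW_append_pair {k d : ℕ} (hk : 1 ≤ k) (hd : 1 ≤ d) (s : ℕ) {θ : ℕ → ℕ}
    (hθ : ∀ n, 1 ≤ θ n) :
    cfVal (app (betaW k s ++ [1, d]) θ) = (betaMap k)^[s] (1 / (1 + 1 / (d + cfVal θ))) := by
  have hd' : ∀ e ∈ [d], 1 ≤ e := by simpa using hd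
  rw [cfVal_app_betaW_append hk s (by simpa using hd) hθ, cfVal_app_cons le_rfl hd' hθ,
    cfVal_app_singleton hd hθ, Nat.cast_one]

lemma exists_betaMap_iterate_eq_moebius (k s : ℕ) : ∃ A T r : ℝ, 0 < T ∧ 0 ≤ r ∧
    ∀ y : ℝ, 0 < y → (betaMap k)^[s] (1 / (1 + 1 / y)) = moebius A T r y := by
  induction s with
  | zero =>
    refine ⟨1, 1, 1, one_pos, zero_le_one, fun y hy => ?_⟩
    simp only [Function.iterate_zero, id, moebius]
    have : 1 + 1 / y ≠ 0 := by positivity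
    field_simp
    ring
  | succ s ih =>
    obtain ⟨A, T, r, hT, hr, h⟩ := ih
    obtain ⟨u, hu⟩ : ∃ u : ℝ, u = k + 1 + r := ⟨_, rfl⟩
    have hu1 : 1 ≤ u := by rw [hu]; linarith [(Nat.cast_nonneg k : (0 : ℝ) ≤ k)]
    have hu0 : 0 < u := by linarith
    refine ⟨A - T / u, T / u ^ 2, 1 - 1 / u, by positivity, ?_, fun y hy => ?_⟩
    · rw [sub_nonneg, div_le_one hu0]
      exact hu1
    · have h1 : k + 1 / (1 + 1 / y) + r = (u * (y + 1) - 1) / (y + 1) := by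
        rw [hu]
        field_simp
        ring
      have h2 : y + (1 - 1 / u) = (u * (y + 1) - 1) / u := by
        field_simp
        ring
      have h3 : u * (y + 1) - 1 ≠ 0 := by nlinarith
      rw [Function.iterate_succ_apply, betaMap, h _ (by positivity), moebius, moebius, h1, h2]
      field_simp
      ring

lemma tendsto_betaMap_iterate {k : ℕ} (hk : 1 ≤ k) {x b : ℝ} (hx : 0 ≤ x) (hb : 0 ≤ b)
    (hfix : betaMap k b = b) : Tendsto (fun s => (betaMap k)^[s] x) atTop (𝓝 b) := by
  have hk' : (1 : ℝ) ≤ k := by exact_mod_cast hk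
  have h : ∀ s, 0 ≤ (betaMap k)^[s] x ∧ |(betaMap k)^[s] x - b| ≤ |x - b| * (1 / 4) ^ s := by
    intro s
    induction s with
    | zero => simpa using hx
    | succ s ih =>
      obtain ⟨h0, ih⟩ := ih
      rw [Function.iterate_succ_apply']
      refine ⟨by unfold betaMap; positivity, ?_⟩
      have := abs_two_step_sub_le le_rfl hk' h0 hb
      calc |betaMap k ((betaMap k)^[s] x) - b|
          = |betaMap k ((betaMap k)^[s] x) - betaMap k b| := by rw [hfix]
        _ ≤ |(betaMap k)^[s] x - b| / 4 := this
        _ ≤ _ := by rw [pow_succ]; linarith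
  rw [tendsto_iff_dist_tendsto_zero]
  refine squeeze_zero (fun _ => dist_nonneg) (fun s => (h s).2) ?_
  simpa using (tendsto_pow_atTop_nhds_zero_of_lt_one (r := (1 / 4 : ℝ)) (by norm_num)
    (by norm_num)).const_mul |x - b|

lemma betaMap_eq_self (k : ℕ) (hk : 1 ≤ k) :
    betaMap k ((√((k : ℝ) ^ 2 + 4 * k) - k) / 2) = (√((k : ℝ) ^ 2 + 4 * k) - k) / 2 := by
  have hk' : (1 : ℝ) ≤ k := by exact_mod_cast hk
  have hsq := Real.sq_sqrt (show 0 ≤ (k : ℝ) ^ 2 + 4 * k by positivity)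
  have hpos := Real.sqrt_nonneg ((k : ℝ) ^ 2 + 4 * k)
  set R := √((k : ℝ) ^ 2 + 4 * k)
  unfold betaMap
  have h1 : (0 : ℝ) < k + (R - k) / 2 := by linarith
  rw [div_eq_iff (by positivity)]
  have h2 : (R - k) / 2 * (1 / (k + (R - k) / 2)) = 1 - (R - k) / 2 := by
    rw [mul_one_div, div_eq_iff h1.ne']
    linear_combination hsq / 4
  rw [mul_add, h2]
  ring

lemma image_moebius_subset {k d s : ℕ} {A T r : ℝ} (hk : 1 ≤ k) (hd : 1 ≤ d)
    (hG : ∀ y : ℝ, 0 < y → (betaMap k)^[s] (1 / (1 + 1 / y)) = moebius A T r y) :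
    (fun x => moebius A T r (d + x)) '' boundedCF (k - 1) ⊆ Ck k (betaW k s ++ [1, d]) ∧
    (fun x => moebius A T r (d + x)) '' restrictedCF (k - 1) ⊆ Ctilk k (betaW k s ++ [1, d]) := by
  have hd' : (1 : ℝ) ≤ d := by exact_mod_cast hd
  have key : ∀ θ : ℕ → ℕ, (∀ n, 1 ≤ θ n) →
      moebius A T r (d + cfVal θ) = cfVal (app (betaW k s ++ [1, d]) θ) := fun θ hθ => by
    rw [cfVal_app_betaW_append_pair hk hd s hθ, hG]
    have := (cfVal_mem_Icc θ hθ).1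
    positivity
  constructor
  · rintro _ ⟨_, ⟨θ, hθ, rfl⟩, rfl⟩
    exact ⟨θ, hθ, key θ fun n => (hθ n).1⟩
  · rintro _ ⟨_, ⟨θ, ⟨hθ, hne⟩, rfl⟩, rfl⟩
    exact ⟨θ, hθ, hne, key θ fun n => (hθ n).1⟩

/-- For every integer `k ≥ 5`, the union over `s ≥ 1` of
`k + (C̃_k(β^s) + C_k(γ^s))` and `k + (C_k(β^s) + C_k(β^s))` covers the half-open
interval `[1 + √(k² + 2k - 3), √(k² + 4k))`. -/
theorem covering_interval_k (k : ℕ) (hk : 5 ≤ k) :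
    Set.Ico (1 + Real.sqrt ((k : ℝ) ^ 2 + 2 * k - 3)) (Real.sqrt ((k : ℝ) ^ 2 + 4 * k)) ⊆
      ⋃ (s : ℕ) (_ : 1 ≤ s),
        ({(k : ℝ)} + (Ctilk k (betaW k s) + Ck k (gammaW k s))) ∪
          ({(k : ℝ)} + (Ck k (betaW k s) + Ck k (betaW k s))) := by
  obtain ⟨N, rfl⟩ : ∃ N, k = N + 1 := ⟨k - 1, by omega⟩
  have h := isExtremalPair (show 4 ≤ N by omega)
  set M := (√((N : ℝ) ^ 2 + 4 * N) - N) / 2 with hMdef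
  set m := M / N
  have hM := h.max_pos
  have hN := h.four_le_cast
  have hfix := betaMap_eq_self (N + 1) (by omega)
  set b := (√(((N + 1 : ℕ) : ℝ) ^ 2 + 4 * (N + 1 : ℕ)) - (N + 1 : ℕ)) / 2 with hb
  have hb0 : 0 ≤ b := by
    have : ((N + 1 : ℕ) : ℝ) ≤ √(((N + 1 : ℕ) : ℝ) ^ 2 + 4 * (N + 1 : ℕ)) :=
      Real.le_sqrt_of_sq_le (by linarith [(Nat.cast_nonneg (N + 1) : (0 : ℝ) ≤ (N + 1 : ℕ))])
    linarith
  rintro t ⟨ht, htb⟩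
  have hsqrt : ((N + 1 : ℕ) : ℝ) ^ 2 + 2 * (N + 1 : ℕ) - 3 = (N : ℝ) ^ 2 + 4 * N := by
    push_cast
    ring
  rw [hsqrt] at ht
  have ht' : 2 * M ≤ t - (N + 1 : ℕ) := by
    push_cast
    linarith
  have hex : ∃ s, t - (N + 1 : ℕ) < 2 * (betaMap (N + 1))^[s] M :=
    (((tendsto_betaMap_iterate (by omega) hM.le hb0 hfix).const_mul 2).eventually
      (lt_mem_nhds (by linarith))).exists
  obtain ⟨s, hs, hmin⟩ : ∃ s, t - (N + 1 : ℕ) < 2 * (betaMap (N + 1))^[s + 1] M ∧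
      2 * (betaMap (N + 1))^[s] M ≤ t - (N + 1 : ℕ) := by
    classical
    have hspec := Nat.find_spec hex
    have hpos : Nat.find hex ≠ 0 := fun h0 => by
      rw [h0] at hspec
      exact absurd hspec (not_lt.2 ht')
    obtain ⟨s, hs⟩ := Nat.exists_eq_succ_of_ne_zero hpos
    rw [hs] at hspec
    exact ⟨s, hspec, not_lt.1 (Nat.find_min hex (by omega))⟩
  obtain ⟨A, T, r, hT, hr, hG⟩ := exists_betaMap_iterate_eq_moebius (N + 1) s
  have hlo : (betaMap (N + 1))^[s] M = moebius A T r (N + M) := by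
    rw [← hG _ (by positivity), h.one_div_add_max, h.one_div_one_add_min]
  have hhi : (betaMap (N + 1))^[s + 1] M = moebius A T r ((N + 1 : ℕ) + M) := by
    rw [← hG _ (by positivity)]
    rfl
  rw [hhi] at hs
  rw [hlo] at hmin
  obtain ⟨hβ, hβ'⟩ := image_moebius_subset (d := N + 1) (by omega) (by omega) hG
  obtain ⟨hγ, -⟩ := image_moebius_subset (d := N) (by omega) (by omega) hG
  rw [← betaW_succ, Nat.add_sub_cancel] at hβ hβ'
  have hγW : gammaW (N + 1) (s + 1) = betaW (N + 1) s ++ [1, N] := rfl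
  rw [← hγW, Nat.add_sub_cancel] at hγ
  refine mem_iUnion₂.2 ⟨s + 1, by omega, ?_⟩
  rw [← Set.add_union]
  refine ⟨_, rfl, t - (N + 1 : ℕ), ?_, by simp⟩
  exact Set.union_subset_union (Set.add_subset_add hβ' hγ) (Set.add_subset_add hβ hβ)
    (Icc_subset_add_union_add h hT hr ⟨hmin, hs.le⟩)
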